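/- Fix ω > 0, c ∈ [0,1], β > 0, a positive integer n, and h > 0 satisfying the stability condition (c h + 2 arctan(h(1+(1−c²)ω²)/(2cω²)) < π if c ∈ (0,1]; h < 2ω/√(1+ω²) if c = 0), so that M̃_{h,c} can be written as [[cos θ_h, χ_h sin θ_h],[−χ_h⁻¹ sin θ_h, cos θ_h]] with cos θ_h = trace(M̃_{h,c})/2, sin θ_h ≠ 0, and χ_h = sin(ch)/(cω² sin θ_h) for c ∈ (0,1] (χ_h = h/(ω² sin θ_h) for c = 0). Let (q₀,p₀) be a random vector in ℝ² with unnormalized density e^{−βH(q,p)}, where H(q,p) = (1/2)ω⁻²p² + (1/2)(ω²+1)q², and let Δ = H(M̃_{h,c}ⁿ(q₀,p₀)) − H(q₀,p₀) be the energy error after n steps. Then E(Δ) = β⁻¹ sin²(nθ_h) ρ(c,ω,h), where ρ(c,ω,h) = (1/2)(χ̂_h − 1/χ̂_h)² ≥ 0 and χ̂_h² = (ω² + ω⁴) χ_h². Consequently 0 ≤ E(Δ) ≤ β⁻¹ρ(c,ω,h). -/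

import Mathlib

open Matrix

/-- One-step matrix of the PHMC splitting integrator with parameter `c ∈ [0,1]` applied to
the model Hamiltonian `H(q,p) = (1/2)ω⁻²p² + (1/2)(ω²+1)q²`. -/
noncomputable def phmcMatrix (ω c h : ℝ) : Matrix (Fin 2) (Fin 2) ℝ :=
  if c = 0 then
    !![1 - h ^ 2 / (2 * ω ^ 2) * (1 + ω ^ 2), h / ω ^ 2;
       h * (1 + ω ^ 2) * (h ^ 2 - (4 - h ^ 2) * ω ^ 2) / (4 * ω ^ 2),
       1 - h ^ 2 / (2 * ω ^ 2) * (1 + ω ^ 2)]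
  else
    !![Real.cos (c * h) -
         h * (1 + (1 - c ^ 2) * ω ^ 2) / (2 * c * ω ^ 2) * Real.sin (c * h),
       Real.sin (c * h) / (c * ω ^ 2);
       -(h * (1 + (1 - c ^ 2) * ω ^ 2)) * Real.cos (c * h) -
         (4 * c ^ 2 * ω ^ 4 - h ^ 2 * (1 + (1 - c ^ 2) * ω ^ 2) ^ 2) / (4 * c * ω ^ 2) *
           Real.sin (c * h),
       Real.cos (c * h) -
         h * (1 + (1 - c ^ 2) * ω ^ 2) / (2 * c * ω ^ 2) * Real.sin (c * h)]

/-- The model Hamiltonian `H(q,p) = (1/2)ω⁻²p² + (1/2)(ω²+1)q²`. -/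
noncomputable def phmcHamiltonian (ω : ℝ) (x : ℝ × ℝ) : ℝ :=
  1 / 2 * (ω ^ 2)⁻¹ * x.2 ^ 2 + 1 / 2 * (ω ^ 2 + 1) * x.1 ^ 2

lemma integral_mul_exp_neg_mul_sq_eq_zero (b : ℝ) :
    ∫ x : ℝ, x * Real.exp (-b * x ^ 2) = 0 := by
  have h := MeasureTheory.integral_neg_eq_self (fun x : ℝ => x * Real.exp (-b * x ^ 2))
    MeasureTheory.volume
  simp only [neg_sq, neg_mul, MeasureTheory.integral_neg] at h ⊢
  linarith

lemma integrable_sq_mul_exp_neg_mul_sq {b : ℝ} (hb : 0 < b) :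
    MeasureTheory.Integrable fun x : ℝ => x ^ 2 * Real.exp (-b * x ^ 2) := by
  simpa using integrable_rpow_mul_exp_neg_mul_sq hb (s := 2) (by norm_num)

/-- The second moment of an unnormalized centered Gaussian. -/
lemma integral_sq_mul_exp_neg_mul_sq {b : ℝ} (hb : 0 < b) :
    ∫ x : ℝ, x ^ 2 * Real.exp (-b * x ^ 2) = (2 * b)⁻¹ * ∫ x : ℝ, Real.exp (-b * x ^ 2) := by
  have hd : ∀ x : ℝ, HasDerivAt (fun x : ℝ => x * Real.exp (-b * x ^ 2))
      (Real.exp (-b * x ^ 2) - 2 * b * (x ^ 2 * Real.exp (-b * x ^ 2))) x := by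
    intro x
    have h := (hasDerivAt_id x).mul (((hasDerivAt_pow 2 x).const_mul (-b)).exp)
    refine h.congr_deriv ?_
    simp only [id_eq]
    push_cast
    ring
  have h0 := integrable_exp_neg_mul_sq hb
  have h2 := (integrable_sq_mul_exp_neg_mul_sq hb).const_mul (2 * b)
  have h := MeasureTheory.integral_eq_zero_of_hasDerivAt_of_integrable hd (h0.sub h2)
    (integrable_mul_exp_neg_mul_sq hb)
  rw [MeasureTheory.integral_sub h0 h2, MeasureTheory.integral_const_mul] at h
  rw [eq_inv_mul_iff_mul_eq₀ (by positivity)]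
  linarith

/-- The unnormalized mean of a binary quadratic form under a product of centered Gaussians. -/
lemma integral_quadratic_mul_exp_neg {a b : ℝ} (ha : 0 < a) (hb : 0 < b) (A B C : ℝ) :
    ∫ x : ℝ × ℝ, (A * x.1 ^ 2 + B * (x.1 * x.2) + C * x.2 ^ 2) *
        Real.exp (-a * x.1 ^ 2 + -b * x.2 ^ 2) =
      (A / (2 * a) + C / (2 * b)) *
        ∫ x : ℝ × ℝ, Real.exp (-a * x.1 ^ 2 + -b * x.2 ^ 2) := by
  have h0a := integrable_exp_neg_mul_sq ha
  have h0b := integrable_exp_neg_mul_sq hb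
  have h1 := ((integrable_sq_mul_exp_neg_mul_sq ha).mul_prod h0b).const_mul A
  have h2 := ((integrable_mul_exp_neg_mul_sq ha).mul_prod
    (integrable_mul_exp_neg_mul_sq hb)).const_mul B
  have h3 := (h0a.mul_prod (integrable_sq_mul_exp_neg_mul_sq hb)).const_mul C
  have hsplit : ∀ x : ℝ × ℝ, (A * x.1 ^ 2 + B * (x.1 * x.2) + C * x.2 ^ 2) *
        Real.exp (-a * x.1 ^ 2 + -b * x.2 ^ 2) =
      A * (x.1 ^ 2 * Real.exp (-a * x.1 ^ 2) * Real.exp (-b * x.2 ^ 2)) +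
      B * (x.1 * Real.exp (-a * x.1 ^ 2) * (x.2 * Real.exp (-b * x.2 ^ 2))) +
      C * (Real.exp (-a * x.1 ^ 2) * (x.2 ^ 2 * Real.exp (-b * x.2 ^ 2))) := by
    intro x
    rw [Real.exp_add]
    ring
  simp only [hsplit]
  simp only [Real.exp_add, MeasureTheory.Measure.volume_eq_prod]
  rw [MeasureTheory.integral_add (by exact h1.add h2) h3, MeasureTheory.integral_add h1 h2,
    MeasureTheory.integral_const_mul, MeasureTheory.integral_const_mul,
    MeasureTheory.integral_const_mul,
    MeasureTheory.integral_prod_mul (fun q : ℝ => q ^ 2 * Real.exp (-a * q ^ 2))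
      (fun p : ℝ => Real.exp (-b * p ^ 2)),
    MeasureTheory.integral_prod_mul (fun q : ℝ => q * Real.exp (-a * q ^ 2))
      (fun p : ℝ => p * Real.exp (-b * p ^ 2)),
    MeasureTheory.integral_prod_mul (fun q : ℝ => Real.exp (-a * q ^ 2))
      (fun p : ℝ => p ^ 2 * Real.exp (-b * p ^ 2)),
    MeasureTheory.integral_prod_mul (fun q : ℝ => Real.exp (-a * q ^ 2))
      (fun p : ℝ => Real.exp (-b * p ^ 2)),
    integral_mul_exp_neg_mul_sq_eq_zero a, integral_sq_mul_exp_neg_mul_sq ha,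
    integral_sq_mul_exp_neg_mul_sq hb]
  ring

lemma integral_exp_neg_mul_sq_add_pos {a b : ℝ} (ha : 0 < a) (hb : 0 < b) :
    0 < ∫ x : ℝ × ℝ, Real.exp (-a * x.1 ^ 2 + -b * x.2 ^ 2) := by
  simp only [Real.exp_add, MeasureTheory.Measure.volume_eq_prod]
  rw [MeasureTheory.integral_prod_mul (fun q : ℝ => Real.exp (-a * q ^ 2))
      (fun p : ℝ => Real.exp (-b * p ^ 2)), integral_gaussian, integral_gaussian]
  positivity

/-- Powers of a symplectic rotation-like matrix. -/
lemma rotationLike_pow (θ : ℝ) {χ : ℝ} (hχ : χ ≠ 0) (n : ℕ) :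
    !![Real.cos θ, χ * Real.sin θ; -χ⁻¹ * Real.sin θ, Real.cos θ] ^ n =
      !![Real.cos (n * θ), χ * Real.sin (n * θ);
         -χ⁻¹ * Real.sin (n * θ), Real.cos (n * θ)] := by
  induction n with
  | zero => simp [Matrix.one_fin_two]
  | succ k ih =>
    rw [pow_succ, ih, Matrix.mul_fin_two]
    push_cast
    rw [add_mul, one_mul, Real.cos_add, Real.sin_add]
    ext i j
    fin_cases i <;> fin_cases j <;> simp <;> field_simp <;> ring

lemma phmcMatrix_diag (ω c h : ℝ) : phmcMatrix ω c h 1 1 = phmcMatrix ω c h 0 0 := by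
  unfold phmcMatrix
  split_ifs <;> simp

lemma phmcMatrix_det {ω : ℝ} (hω : ω ≠ 0) (c h : ℝ) : (phmcMatrix ω c h).det = 1 := by
  unfold phmcMatrix
  split_ifs with hc
  · rw [Matrix.det_fin_two_of]
    field_simp
    ring
  · rw [Matrix.det_fin_two_of]
    have := Real.sin_sq_add_cos_sq (c * h)
    field_simp
    linear_combination (16 * c ^ 2 * ω ^ 4) * this

/-- A symplectic reversible matrix with stable trace and nonzero upper-right entry is
rotation-like. -/
lemma eq_rotationLike {M : Matrix (Fin 2) (Fin 2) ℝ} (hdiag : M 1 1 = M 0 0) (hdet : M.det = 1)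
    {θ χ : ℝ} (hχ : χ ≠ 0) (hsin : Real.sin θ ≠ 0) (hcos : Real.cos θ = M.trace / 2)
    (h01 : M 0 1 = χ * Real.sin θ) :
    M = !![Real.cos θ, χ * Real.sin θ; -χ⁻¹ * Real.sin θ, Real.cos θ] := by
  rw [Matrix.trace_fin_two, hdiag] at hcos
  rw [Matrix.det_fin_two, hdiag, h01] at hdet
  have h00 : M 0 0 = Real.cos θ := by linarith
  have h10 : M 1 0 = -χ⁻¹ * Real.sin θ := by
    have := Real.sin_sq_add_cos_sq θ
    rw [h00] at hdet
    field_simp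
    apply mul_right_cancel₀ hsin
    linear_combination -hdet + this
  rw [Matrix.eta_fin_two M, hdiag, h00, h01, h10]

/-- For a stable step size, writing the PHMC one-step matrix in the form
`[[cos θ_h, χ_h sin θ_h],[−χ_h⁻¹ sin θ_h, cos θ_h]]`, the expected energy error after `n`
steps over initial conditions with unnormalized density `e^{−βH}` is
`E(Δ) = β⁻¹ sin²(nθ_h) ρ(c,ω,h)` with `ρ = (1/2)(χ̂_h − 1/χ̂_h)² ≥ 0`,
`χ̂_h² = (ω²+ω⁴)χ_h²`; consequently `0 ≤ E(Δ) ≤ β⁻¹ρ(c,ω,h)`. -/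
theorem phmc_mean_energy_error
    (ω c h : ℝ) (hω : 0 < ω) (hc : c ∈ Set.Icc (0 : ℝ) 1) (hh : 0 < h)
    (β : ℝ) (hβ : 0 < β) (n : ℕ) (hn : 0 < n)
    (hstab₁ : c ≠ 0 →
      c * h + 2 * Real.arctan (h * (1 + (1 - c ^ 2) * ω ^ 2) / (2 * c * ω ^ 2)) < Real.pi)
    (hstab₂ : c = 0 → h < 2 * ω / Real.sqrt (1 + ω ^ 2))
    (θh χh : ℝ)
    (hcos : Real.cos θh = (phmcMatrix ω c h).trace / 2)
    (hsin : Real.sin θh ≠ 0)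
    (hχ : χh = if c = 0 then h / (ω ^ 2 * Real.sin θh)
        else Real.sin (c * h) / (c * ω ^ 2 * Real.sin θh)) :
    let χhat := Real.sqrt ((ω ^ 2 + ω ^ 4) * χh ^ 2)
    let ρ := 1 / 2 * (χhat - 1 / χhat) ^ 2
    let EΔ := (∫ x : ℝ × ℝ,
        (phmcHamiltonian ω (((phmcMatrix ω c h) ^ n).mulVec ![x.1, x.2] 0,
                            ((phmcMatrix ω c h) ^ n).mulVec ![x.1, x.2] 1)
          - phmcHamiltonian ω x) * Real.exp (-β * phmcHamiltonian ω x)) /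
      (∫ x : ℝ × ℝ, Real.exp (-β * phmcHamiltonian ω x))
    0 ≤ ρ ∧ EΔ = β⁻¹ * (Real.sin (n * θh) ^ 2 * ρ) ∧ 0 ≤ EΔ ∧ EΔ ≤ β⁻¹ * ρ := by
  intro χhat ρ EΔ
  have h01 : phmcMatrix ω c h 0 1 = χh * Real.sin θh := by
    rw [hχ]
    unfold phmcMatrix
    split_ifs with h0
    · simp
      field_simp
    · simp
      field_simp
  have hχ0 : χh ≠ 0 := by
    rw [hχ]
    split_ifs with h0
    · positivity
    · have hc0 : 0 < c := lt_of_le_of_ne hc.1 (Ne.symm h0)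
      have hc1 : 0 ≤ 1 - c ^ 2 := by nlinarith [hc.2]
      have harg : 0 ≤ Real.arctan (h * (1 + (1 - c ^ 2) * ω ^ 2) / (2 * c * ω ^ 2)) :=
        Real.arctan_nonneg.2 (by positivity)
      have hs : 0 < Real.sin (c * h) :=
        Real.sin_pos_of_pos_of_lt_pi (by positivity) (by linarith [hstab₁ h0])
      have := hs.ne'
      positivity
  have hM := eq_rotationLike (phmcMatrix_diag ω c h) (phmcMatrix_det hω.ne' c h) hχ0 hsin hcos h01
  have hρ : 0 ≤ ρ := by positivity
  have hχhat : χhat ^ 2 = (ω ^ 2 + ω ^ 4) * χh ^ 2 := Real.sq_sqrt (by positivity)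
  have hχhat0 : χhat ≠ 0 := by
    intro h0
    have : 0 < (ω ^ 2 + ω ^ 4) * χh ^ 2 := by positivity
    rw [← hχhat, h0] at this
    simp at this
  have hρeq : ρ = 1 / 2 * (χhat ^ 2 - 2 + 1 / χhat ^ 2) := by
    simp only [ρ]
    field_simp
    ring
  have ha : 0 < β * (1 / 2 * (ω ^ 2 + 1)) := by positivity
  have hb : 0 < β * (1 / 2 * (ω ^ 2)⁻¹) := by positivity
  set s := Real.sin (n * θh) with hs
  set k := Real.cos (n * θh) with hk
  have hsk : s ^ 2 + k ^ 2 = 1 := Real.sin_sq_add_cos_sq _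
  have hexp : ∀ x : ℝ × ℝ, -β * phmcHamiltonian ω x =
      -(β * (1 / 2 * (ω ^ 2 + 1))) * x.1 ^ 2 + -(β * (1 / 2 * (ω ^ 2)⁻¹)) * x.2 ^ 2 := by
    intro x
    unfold phmcHamiltonian
    ring
  have hΔ : ∀ x : ℝ × ℝ,
      phmcHamiltonian ω (((phmcMatrix ω c h) ^ n).mulVec ![x.1, x.2] 0,
          ((phmcMatrix ω c h) ^ n).mulVec ![x.1, x.2] 1) - phmcHamiltonian ω x =
        s ^ 2 * (1 / 2 * (ω ^ 2)⁻¹ * χh⁻¹ ^ 2 - 1 / 2 * (ω ^ 2 + 1)) * x.1 ^ 2 +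
        s * k * ((ω ^ 2 + 1) * χh - (ω ^ 2)⁻¹ * χh⁻¹) * (x.1 * x.2) +
        s ^ 2 * (1 / 2 * (ω ^ 2 + 1) * χh ^ 2 - 1 / 2 * (ω ^ 2)⁻¹) * x.2 ^ 2 := by
    intro x
    rw [hM, rotationLike_pow θh hχ0 n]
    simp only [phmcHamiltonian, Matrix.mulVec, dotProduct, Fin.sum_univ_two, Matrix.of_apply,
      Matrix.cons_val_zero, Matrix.cons_val_one, Matrix.cons_val', ← hs, ← hk]
    linear_combination (1 / 2 * (ω ^ 2)⁻¹ * x.2 ^ 2 + 1 / 2 * (ω ^ 2 + 1) * x.1 ^ 2) * hsk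
  have hE : EΔ = β⁻¹ * (s ^ 2 * ρ) := by
    simp only [EΔ, hexp, hΔ]
    rw [integral_quadratic_mul_exp_neg ha hb,
      mul_div_cancel_right₀ _ (integral_exp_neg_mul_sq_add_pos ha hb).ne', hρeq, hχhat]
    field_simp
    ring
  have hs1 : s ^ 2 ≤ 1 := Real.sin_sq_le_one _
  refine ⟨hρ, hE, ?_, ?_⟩
  · rw [hE]
    positivity
  · rw [hE]
    gcongr
    exact mul_le_of_le_one_left hρ hs1
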